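/- Let q, z be complex numbers with |q| < 1. Then ∑_{n=1}^∞ ( (-z)^{n-1} q^{n(n+1)/2} ) / ( (q;q)_n (1 - q^n) ) = ∑_{n=1}^∞ n q^n (z q^{n+1};q)_∞. (This is a one-variable generalization of Uchimura's identity, which is the case z = 1.) -/

import Mathlib

/-- The finite q-Pochhammer symbol `(A;q)_n = (1-A)(1-Aq)⋯(1-Aq^{n-1})`. -/
noncomputable def qPoch (q A : ℂ) (n : ℕ) : ℂ := ∏ k ∈ Finset.range n, (1 - A * q ^ k)

/-- The infinite q-Pochhammer symbol `(A;q)_∞ = ∏_{k≥0} (1 - A q^k)`. -/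
noncomputable def qPochInf (q A : ℂ) : ℂ := ∏' k : ℕ, (1 - A * q ^ k)

open Filter Topology

/-- The `k`-th term of Euler's expansion of `(A;q)_∞`. -/
noncomputable def eulerTerm (q A : ℂ) (k : ℕ) : ℂ := (-A) ^ k * q ^ k.choose 2 / qPoch q q k

theorem one_sub_pow_succ_ne_zero {q : ℂ} (hq : ‖q‖ < 1) (n : ℕ) : 1 - q ^ (n + 1) ≠ 0 := by
  intro h
  have h1 : ‖q ^ (n + 1)‖ < 1 := by
    rw [norm_pow]
    exact pow_lt_one₀ (norm_nonneg q) hq n.succ_ne_zero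
  rw [← sub_eq_zero.mp h] at h1
  simp at h1

theorem qPoch_self_succ (q : ℂ) (n : ℕ) :
    qPoch q q (n + 1) = qPoch q q n * (1 - q ^ (n + 1)) := by
  rw [qPoch, Finset.prod_range_succ, ← qPoch, ← pow_succ']

theorem qPoch_self_ne_zero {q : ℂ} (hq : ‖q‖ < 1) (n : ℕ) : qPoch q q n ≠ 0 := by
  refine Finset.prod_ne_zero_iff.mpr fun k _ => ?_
  rw [← pow_succ']
  exact one_sub_pow_succ_ne_zero hq k

theorem eulerTerm_zero (q A : ℂ) : eulerTerm q A 0 = 1 := by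
  simp [eulerTerm, qPoch]

theorem eulerTerm_succ (q A : ℂ) (k : ℕ) :
    eulerTerm q A (k + 1) = -A * q ^ k / (1 - q ^ (k + 1)) * eulerTerm q A k := by
  have h : (k + 1).choose 2 = k + k.choose 2 := by simp [Nat.choose_succ_succ' k 1]
  simp only [eulerTerm, qPoch_self_succ, h, pow_add, pow_one, div_eq_mul_inv, mul_inv]
  ring

theorem eulerTerm_mul (q A B : ℂ) (k : ℕ) : eulerTerm q (A * B) k = eulerTerm q A k * B ^ k := by
  rw [eulerTerm, eulerTerm, ← neg_mul, mul_pow]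
  ring

theorem summable_norm_eulerTerm {q : ℂ} (hq : ‖q‖ < 1) (A : ℂ) :
    Summable fun k => ‖eulerTerm q A k‖ := by
  have hp := tendsto_pow_atTop_nhds_zero_of_norm_lt_one hq
  have hlim : Tendsto (fun k : ℕ => ‖-A * q ^ k / (1 - q ^ (k + 1))‖) atTop (𝓝 0) := by
    have h := ((hp.const_mul (-A)).div ((hp.comp (tendsto_add_atTop_nat 1)).const_sub 1)
      (by simp)).norm
    simpa using h
  refine summable_of_ratio_norm_eventually_le (r := 1 / 2) (by norm_num) ?_
  filter_upwards [hlim.eventually_le_const (show (0 : ℝ) < 1 / 2 by norm_num)] with k hk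
  rw [norm_norm, norm_norm, eulerTerm_succ, norm_mul]
  gcongr

theorem tsum_eulerTerm_eq_mul {q : ℂ} (hq : ‖q‖ < 1) (A : ℂ) :
    ∑' k, eulerTerm q A k = (1 - A) * ∑' k, eulerTerm q (A * q) k := by
  have hA := (summable_norm_eulerTerm hq A).of_norm
  have hAq := (summable_norm_eulerTerm hq (A * q)).of_norm
  have hstep : ∀ k, eulerTerm q A (k + 1)
      = eulerTerm q (A * q) (k + 1) - A * eulerTerm q (A * q) k := by
    intro k
    have h := one_sub_pow_succ_ne_zero hq k
    rw [eulerTerm_mul, eulerTerm_mul, eulerTerm_succ]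
    field_simp
    ring
  rw [hA.tsum_eq_zero_add, one_sub_mul]
  simp_rw [hstep]
  rw [((summable_nat_add_iff 1).mpr hAq).tsum_sub (hAq.mul_left A), tsum_mul_left,
    eulerTerm_zero, hAq.tsum_eq_zero_add (f := eulerTerm q (A * q)), eulerTerm_zero]
  ring

theorem tsum_eulerTerm_eq_qPoch_mul {q : ℂ} (hq : ‖q‖ < 1) (A : ℂ) (n : ℕ) :
    ∑' k, eulerTerm q A k = qPoch q A n * ∑' k, eulerTerm q (A * q ^ n) k := by
  induction n with
  | zero => simp [qPoch]
  | succ n ih =>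
    rw [ih, tsum_eulerTerm_eq_mul hq (A * q ^ n), qPoch, qPoch, Finset.prod_range_succ, pow_succ,
      mul_assoc, mul_assoc]

theorem tendsto_qPoch {q : ℂ} (hq : ‖q‖ < 1) (A : ℂ) :
    Tendsto (qPoch q A) atTop (𝓝 (qPochInf q A)) := by
  have hs : Summable fun k : ℕ => ‖-(A * q ^ k)‖ := by
    simp only [norm_neg, norm_mul, norm_pow]
    exact (summable_geometric_of_lt_one (norm_nonneg q) hq).mul_left _
  have h := (multipliable_one_add_of_summable hs).hasProd.tendsto_prod_nat
  simp only [← sub_eq_add_neg] at h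
  exact h

theorem tendsto_tsum_eulerTerm {q : ℂ} (hq : ‖q‖ < 1) (A : ℂ) :
    Tendsto (fun n : ℕ => ∑' k, eulerTerm q (A * q ^ n) k) atTop (𝓝 1) := by
  have h1 : ∑' k, eulerTerm q 0 k = 1 := by
    rw [tsum_eq_single 0 (fun k hk => by simp [eulerTerm, hk]), eulerTerm_zero]
  rw [← h1]
  refine tendsto_tsum_of_dominated_convergence (summable_norm_eulerTerm hq A) (fun k => ?_)
    (Eventually.of_forall fun n k => ?_)
  · have hp := (tendsto_pow_atTop_nhds_zero_of_norm_lt_one hq).const_mul A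
    rw [mul_zero] at hp
    exact ((hp.neg.pow k).mul_const _).div_const _
  · rw [eulerTerm_mul, norm_mul, norm_pow, norm_pow]
    exact mul_le_of_le_one_right (norm_nonneg _)
      (pow_le_one₀ (by positivity) (pow_le_one₀ (norm_nonneg q) hq.le))

/-- Euler's expansion of the infinite `q`-Pochhammer symbol. -/
theorem qPochInf_eq_tsum {q : ℂ} (hq : ‖q‖ < 1) (A : ℂ) :
    qPochInf q A = ∑' k, eulerTerm q A k := by
  have h := (tendsto_qPoch hq A).mul (tendsto_tsum_eulerTerm hq A)
  simp only [← tsum_eulerTerm_eq_qPoch_mul hq A, mul_one] at h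
  exact tendsto_nhds_unique h tendsto_const_nhds

theorem hasSum_succ_mul_geometric {r : ℂ} (hr : ‖r‖ < 1) :
    HasSum (fun n : ℕ => (n + 1 : ℂ) * r ^ (n + 1)) (r / (1 - r) ^ 2) := by
  have h := (hasSum_nat_add_iff' (f := fun n : ℕ => (n : ℂ) * r ^ n) 1).mpr
    (hasSum_coe_mul_geometric_of_norm_lt_one hr)
  simpa using h

theorem stmt15 (q z : ℂ) (hq : ‖q‖ < 1) :
    ∑' n : ℕ, ((-z) ^ n * q ^ ((n + 1) * (n + 2) / 2)) /
        (qPoch q q (n + 1) * (1 - q ^ (n + 1)))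
      = ∑' n : ℕ, (n + 1 : ℂ) * q ^ (n + 1) * qPochInf q (z * q ^ (n + 2)) := by
  have hsum : Summable (Function.uncurry fun n k : ℕ =>
      (n + 1 : ℂ) * q ^ (n + 1) * eulerTerm q (z * q ^ (n + 2)) k) := by
    refine .of_norm_bounded ((hasSum_succ_mul_geometric hq).summable.norm.mul_of_nonneg
      (summable_norm_eulerTerm hq z) (fun _ => norm_nonneg _) (fun _ => norm_nonneg _)) ?_
    rintro ⟨n, k⟩
    simp only [Function.uncurry_apply_pair]
    rw [norm_mul, eulerTerm_mul, norm_mul (eulerTerm q z k), norm_pow, norm_pow]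
    gcongr
    exact mul_le_of_le_one_right (norm_nonneg _)
      (pow_le_one₀ (by positivity) (pow_le_one₀ (norm_nonneg q) hq.le))
  simp_rw [qPochInf_eq_tsum hq, ← tsum_mul_left]
  rw [← hsum.tsum_comm]
  refine tsum_congr fun k => ?_
  have hr : ‖q ^ (k + 1)‖ < 1 := by
    rw [norm_pow]
    exact pow_lt_one₀ (norm_nonneg q) hq k.succ_ne_zero
  have hterm : ∀ n : ℕ, (n + 1 : ℂ) * q ^ (n + 1) * eulerTerm q (z * q ^ (n + 2)) k
      = eulerTerm q z k * q ^ k * ((n + 1 : ℂ) * (q ^ (k + 1)) ^ (n + 1)) := by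
    intro n
    rw [eulerTerm_mul]
    ring
  simp_rw [hterm]
  rw [tsum_mul_left, (hasSum_succ_mul_geometric hr).tsum_eq, eulerTerm, qPoch_self_succ]
  have hexp : (k + 1) * (k + 2) / 2 = k.choose 2 + k + (k + 1) := by
    have h : (k + 2).choose 2 = (k + 1) * (k + 2) / 2 := by
      rw [Nat.choose_two_right, mul_comm]
      rfl
    rw [← h, Nat.choose_succ_succ' (k + 1) 1, Nat.choose_succ_succ' k 1]
    simp only [Nat.choose_one_right, Nat.reduceAdd]
    ring
  have h1 := one_sub_pow_succ_ne_zero hq k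
  have h2 := qPoch_self_ne_zero hq k
  rw [hexp, pow_add, pow_add]
  field_simp
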